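/- arXiv:2603.08939 — 3 statements merged into one kernel-verified Lean document; each statement's English description precedes it below -/
import Mathlib

section
/- Let Q : [0,1] → [0,∞) be a bounded, convex, non-decreasing function with Q(0) = lim_{u↓0} Q(u) = 0. Then ∫_0^1 (3u − 2) Q(u) du ≥ 0. -/
open MeasureTheory Set Filter

/-- A convex function on `[0,1]` vanishing at `0` is star-shaped. -/
theorem ConvexOn.map_mul_le_mul_of_zero {Q : ℝ → ℝ} (hconv : ConvexOn ℝ (Set.Icc (0:ℝ) 1) Q)
    (hQ0 : Q 0 = 0) {a v : ℝ} (ha : a ∈ Set.Icc (0:ℝ) 1) (hv : v ∈ Set.Icc (0:ℝ) 1) :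
    Q (a * v) ≤ a * Q v := by
  have h := hconv.2 hv (Set.left_mem_Icc.2 zero_le_one) ha.1 (sub_nonneg.2 ha.2)
    (add_sub_cancel a 1)
  simpa [hQ0] using h

/-- key inequality in Example 3.6. Let `Q : [0,1] → [0,∞)` be bounded,
convex and non-decreasing with `Q(0) = lim_{u↓0} Q(u) = 0`. Then
`∫_0^1 (3u − 2) Q(u) du ≥ 0`. -/
theorem integral_three_u_sub_two_mul_nonneg
    (Q : ℝ → ℝ)
    (hbdd : ∃ C : ℝ, ∀ u ∈ Set.Icc (0:ℝ) 1, |Q u| ≤ C)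
    (hnonneg : ∀ u ∈ Set.Icc (0:ℝ) 1, 0 ≤ Q u)
    (hconv : ConvexOn ℝ (Set.Icc (0:ℝ) 1) Q)
    (hmono : MonotoneOn Q (Set.Icc (0:ℝ) 1))
    (hQ0 : Q 0 = 0)
    (hlim : Filter.Tendsto Q (nhdsWithin 0 (Set.Ioi 0)) (nhds 0)) :
    0 ≤ ∫ u in Set.Icc (0:ℝ) 1, (3 * u - 2) * Q u := by
  have hint : IntegrableOn (fun u : ℝ => (3 * u - 2) * Q u) (Set.Icc 0 1) :=
    (hmono.integrableOn_isCompact isCompact_Icc).continuousOn_mul (by fun_prop) isCompact_Icc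
  have hlin : IntegrableOn (fun u : ℝ => (3 * u - 2) * (3 / 2 * Q (2 / 3) * u)) (Set.Icc 0 1) :=
    ContinuousOn.integrableOn_compact isCompact_Icc (by fun_prop)
  have hzero : ∫ u in Set.Icc (0:ℝ) 1, (3 * u - 2) * (3 / 2 * Q (2 / 3) * u) = 0 := by
    rw [integral_Icc_eq_integral_Ioc, ← intervalIntegral.integral_of_le zero_le_one]
    have hderiv : ∀ u ∈ Set.uIcc (0:ℝ) 1,
        HasDerivAt (fun u : ℝ => 3 / 2 * Q (2 / 3) * (u ^ 3 - u ^ 2))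
          ((3 * u - 2) * (3 / 2 * Q (2 / 3) * u)) u := fun u _ => by
      refine (((hasDerivAt_pow 3 u).sub (hasDerivAt_pow 2 u)).const_mul
        (3 / 2 * Q (2 / 3))).congr_deriv ?_
      push_cast
      ring
    rw [intervalIntegral.integral_eq_sub_of_hasDerivAt hderiv
      (Continuous.intervalIntegrable (by fun_prop) _ _)]
    norm_num
  refine hzero.symm.le.trans (setIntegral_mono_on hlin hint measurableSet_Icc fun u hu => ?_)
  obtain ⟨hu0, hu1⟩ := hu
  rcases le_total u (2 / 3) with h | h
  · have hQ := hconv.map_mul_le_mul_of_zero hQ0 (a := 3 / 2 * u) (v := 2 / 3)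
      ⟨by linarith, by linarith⟩ ⟨by norm_num, by norm_num⟩
    rw [show 3 / 2 * u * (2 / 3) = u by ring] at hQ
    exact mul_le_mul_of_nonpos_left (by linarith) (by linarith)
  · have hpos : 0 < u := by linarith
    have hQ := hconv.map_mul_le_mul_of_zero hQ0 (a := 2 / 3 / u) (v := u)
      ⟨by positivity, (div_le_one hpos).2 h⟩ ⟨hu0, hu1⟩
    rw [div_mul_cancel₀ _ hpos.ne', div_mul_eq_mul_div, le_div_iff₀ hpos] at hQ
    exact mul_le_mul_of_nonneg_left (by linarith) (by linarith)
end

section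
/- Let μ_n = (1/n) Σ_{i=1}^n δ_{x_i} with x_1, …, x_n > 0, and let μ̂_n = proj_{F_{m,2}} μ_n. Then μ̂_n has a density on [0,∞) which is non-increasing, compactly supported, and piecewise constant with finitely many pieces; equivalently, the quantile function of μ̂_n is bounded, piecewise affine on (0,1) with finitely many affine pieces. -/
open MeasureTheory Set Filter

noncomputable def quantile (μ : MeasureTheory.Measure ℝ) (u : ℝ) : ℝ :=
  sInf {x : ℝ | u ≤ (μ (Set.Iic x)).toReal}

def HasFiniteMomentP (p : ℝ) (μ : MeasureTheory.Measure ℝ) : Prop :=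
  MeasureTheory.IsProbabilityMeasure μ ∧
    MeasureTheory.Integrable (fun x => |x| ^ p) μ

noncomputable def Wdist (p : ℝ) (μ ν : MeasureTheory.Measure ℝ) : ℝ :=
  (∫ u in Set.Ioo (0:ℝ) 1, |quantile μ u - quantile ν u| ^ p) ^ (1 / p)

def DisplacementConvex (F : Set (MeasureTheory.Measure ℝ)) : Prop :=
  ∀ μ ∈ F, ∀ ν ∈ F, ∀ t ∈ Set.Icc (0:ℝ) 1, ∃ σ ∈ F,
    ∀ u ∈ Set.Ioo (0:ℝ) 1,
      quantile σ u = (1 - t) * quantile μ u + t * quantile ν u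

def WClosed (p : ℝ) (F : Set (MeasureTheory.Measure ℝ)) : Prop :=
  ∀ (μs : ℕ → MeasureTheory.Measure ℝ) (μ : MeasureTheory.Measure ℝ),
    (∀ n, μs n ∈ F) → HasFiniteMomentP p μ →
    Filter.Tendsto (fun n => Wdist p (μs n) μ) Filter.atTop (nhds 0) → μ ∈ F

/-- The model `F_{m,p}`: probability measures on `[0,∞)` with finite `p`-th moment whose
quantile function is convex, non-decreasing, and tends to `0` as `u ↓ 0`. -/
def Fmp (p : ℝ) : Set (MeasureTheory.Measure ℝ) :=
  {μ | HasFiniteMomentP p μ ∧ μ (Set.Iio (0:ℝ)) = 0 ∧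
    ConvexOn ℝ (Set.Ioo (0:ℝ) 1) (quantile μ) ∧
    MonotoneOn (quantile μ) (Set.Ioo (0:ℝ) 1) ∧
    Filter.Tendsto (quantile μ) (nhdsWithin 0 (Set.Ioi 0)) (nhds 0)}

open scoped Topology

section Convexity

lemma ConvexOn.exists_subgradient {S : Set ℝ} {f : ℝ → ℝ} (hf : ConvexOn ℝ S f) {x : ℝ}
    (hx : x ∈ interior S) : ∃ m : ℝ, ∀ y ∈ S, f x + m * (y - x) ≤ f y := by
  refine ⟨derivWithin f (Ioi x) x, fun y hy => ?_⟩
  rcases lt_trichotomy x y with h | rfl | h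
  · have h1 := hf.rightDeriv_le_slope_of_mem_interior hx hy h
    rw [slope_def_field, le_div_iff₀ (sub_pos.2 h)] at h1
    linarith
  · simp
  · have h1 := (hf.slope_le_leftDeriv_of_mem_interior hy hx h).trans
      (hf.leftDeriv_le_rightDeriv_of_mem_interior hx)
    rw [slope_def_field, div_le_iff₀ (sub_pos.2 h)] at h1
    linarith

lemma convexOn_of_exists_subgradient {S : Set ℝ} {f : ℝ → ℝ} (hS : Convex ℝ S)
    (h : ∀ x ∈ S, ∃ m : ℝ, ∀ y ∈ S, f x + m * (y - x) ≤ f y) : ConvexOn ℝ S f := by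
  refine ⟨hS, fun x hx y hy a b ha hb hab => ?_⟩
  obtain ⟨m, hm⟩ := h _ (hS hx hy ha hb hab)
  have h1 := mul_le_mul_of_nonneg_left (hm x hx) ha
  have h2 := mul_le_mul_of_nonneg_left (hm y hy) hb
  simp only [smul_eq_mul] at *
  obtain rfl : b = 1 - a := by linarith
  nlinarith

lemma ConvexOn.le_chord {S : Set ℝ} {f : ℝ → ℝ} (hf : ConvexOn ℝ S f) {x y z : ℝ}
    (hx : x ∈ S) (hz : z ∈ S) (hxy : x < y) (hyz : y < z) :
    (z - x) * f y ≤ (z - y) * f x + (y - x) * f z :=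
  hf.secant_mono_aux1 hx hz hxy hyz

lemma ConvexOn.monotoneOn_of_nonneg_of_tendsto_zero {f : ℝ → ℝ} (hf : ConvexOn ℝ (Ioo 0 1) f)
    (hf0 : ∀ u ∈ Ioo (0 : ℝ) 1, 0 ≤ f u) (hlim : Tendsto f (𝓝[>] 0) (𝓝 0)) :
    MonotoneOn f (Ioo 0 1) := by
  intro x hx y hy hxy
  rcases hxy.eq_or_lt with rfl | hxy
  · rfl
  have hid : Tendsto (fun e : ℝ => e) (𝓝[>] 0) (𝓝 0) := tendsto_id.mono_left nhdsWithin_le_nhds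
  have h1 : Tendsto (fun e => (y - e) * f x) (𝓝[>] 0) (𝓝 ((y - 0) * f x)) :=
    (tendsto_const_nhds.sub hid).mul_const _
  have h2 : Tendsto (fun e => (y - x) * f e + (x - e) * f y) (𝓝[>] 0)
      (𝓝 ((y - x) * 0 + (x - 0) * f y)) :=
    (hlim.const_mul _).add ((tendsto_const_nhds.sub hid).mul_const _)
  have h3 : (y - 0) * f x ≤ (y - x) * 0 + (x - 0) * f y := by
    refine le_of_tendsto_of_tendsto h1 h2 ?_
    filter_upwards [Ioo_mem_nhdsGT hx.1] with e he
    exact hf.le_chord ⟨he.1, he.2.trans hx.2⟩ hy he.2 hxy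
  have h4 : y * f x ≤ y * f y := by
    nlinarith [hf0 y hy]
  exact le_of_mul_le_mul_left h4 hy.1

lemma MonotoneOn.nonneg_of_tendsto_zero {f : ℝ → ℝ} (hf : MonotoneOn f (Ioo 0 1))
    (hlim : Tendsto f (𝓝[>] 0) (𝓝 0)) {u : ℝ} (hu : u ∈ Ioo (0 : ℝ) 1) : 0 ≤ f u := by
  refine le_of_tendsto hlim ?_
  filter_upwards [Ioo_mem_nhdsGT hu.1] with e he
  exact hf ⟨he.1, he.2.trans hu.2⟩ hu he.2.le

end Convexity

section Quantile

variable {μ : Measure ℝ} [IsProbabilityMeasure μ]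

lemma quantile_le_iff {u : ℝ} (hu : u ∈ Ioo (0 : ℝ) 1) (x : ℝ) :
    quantile μ u ≤ x ↔ u ≤ (μ (Iic x)).toReal := by
  have hF : ∀ y, (μ (Iic y)).toReal = ProbabilityTheory.cdf μ y := fun y =>
    (ProbabilityTheory.cdf_eq_real μ y).symm
  have hbdd : BddBelow {y : ℝ | u ≤ (μ (Iic y)).toReal} := by
    obtain ⟨a, ha⟩ := ((ProbabilityTheory.tendsto_cdf_atBot μ).eventually
      (gt_mem_nhds hu.1)).exists
    refine ⟨a, fun y hy => le_of_lt ?_⟩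
    by_contra! h
    have := ProbabilityTheory.monotone_cdf μ h
    simp only [mem_ofPred_eq, hF] at hy
    linarith
  have hne : {y : ℝ | u ≤ (μ (Iic y)).toReal}.Nonempty := by
    obtain ⟨a, ha⟩ := ((ProbabilityTheory.tendsto_cdf_atTop μ).eventually
      (lt_mem_nhds hu.2)).exists
    exact ⟨a, by simpa only [mem_ofPred_eq, hF] using ha.le⟩
  refine ⟨fun h => ?_, fun h => csInf_le hbdd h⟩
  rw [hF]
  refine ge_of_tendsto (((ProbabilityTheory.cdf μ).right_continuous x).mono_left
    (nhdsWithin_mono x Ioi_subset_Ici_self)) ?_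
  filter_upwards [self_mem_nhdsWithin] with y hy
  obtain ⟨s, hs, hsy⟩ := exists_lt_of_csInf_lt hne (lt_of_le_of_lt h hy)
  simp only [mem_ofPred_eq, hF] at hs
  exact hs.trans (ProbabilityTheory.monotone_cdf μ hsy.le)

lemma monotoneOn_quantile : MonotoneOn (quantile μ) (Ioo 0 1) := fun _ hu _ hv huv =>
  (quantile_le_iff hu _).2 (huv.trans ((quantile_le_iff hv _).1 le_rfl))

lemma aemeasurable_quantile :
    AEMeasurable (quantile μ) (volume.restrict (Ioo (0 : ℝ) 1)) :=
  aemeasurable_restrict_of_monotoneOn measurableSet_Ioo monotoneOn_quantile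

instance isProbabilityMeasure_restrict_Ioo_zero_one : IsProbabilityMeasure (volume.restrict (Ioo (0 : ℝ) 1)) :=
  ⟨by simp⟩

lemma map_quantile : (volume.restrict (Ioo (0 : ℝ) 1)).map (quantile μ) = μ := by
  have := Measure.isProbabilityMeasure_map (μ := volume.restrict (Ioo (0 : ℝ) 1))
    (aemeasurable_quantile (μ := μ))
  refine Measure.ext_of_Iic _ _ fun x => ?_
  rw [Measure.map_apply_of_aemeasurable aemeasurable_quantile measurableSet_Iic,
    Measure.restrict_apply' measurableSet_Ioo]
  have hF : ENNReal.ofReal (μ (Iic x)).toReal = μ (Iic x) :=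
    ENNReal.ofReal_toReal (measure_ne_top _ _)
  have hF1 : (μ (Iic x)).toReal ≤ 1 := 
    ENNReal.toReal_le_of_le_ofReal one_pos.le (by simpa using prob_le_one)
  apply le_antisymm
  · calc volume (quantile μ ⁻¹' Iic x ∩ Ioo 0 1) ≤ volume (Ioc 0 (μ (Iic x)).toReal) :=
          measure_mono fun u hu => ⟨hu.2.1, (quantile_le_iff hu.2 x).1 hu.1⟩
      _ = μ (Iic x) := by simp [hF]
  · calc μ (Iic x) = volume (Ioo 0 (μ (Iic x)).toReal) := by simp [hF]
      _ ≤ volume (quantile μ ⁻¹' Iic x ∩ Ioo 0 1) := measure_mono fun u hu =>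
          have hu' : u ∈ Ioo (0 : ℝ) 1 := ⟨hu.1, hu.2.trans_le hF1⟩
          ⟨(quantile_le_iff hu' x).2 hu.2.le, hu'⟩

lemma memLp_quantile (h : Integrable (fun x => |x| ^ (2 : ℝ)) μ) :
    MemLp (quantile μ) 2 (volume.restrict (Ioo (0 : ℝ) 1)) := by
  have h2 : MemLp (id : ℝ → ℝ) 2 μ := by
    rw [memLp_two_iff_integrable_sq aestronglyMeasurable_id]
    simpa using h
  rw [← map_quantile (μ := μ)] at h2
  exact (memLp_map_measure_iff aestronglyMeasurable_id aemeasurable_quantile).1 h2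

lemma quantile_map_restrict {r : ℝ → ℝ} (hr : MonotoneOn r (Ioo 0 1))
    (hc : ContinuousOn r (Ioo 0 1)) {u : ℝ} (hu : u ∈ Ioo (0 : ℝ) 1) :
    quantile ((volume.restrict (Ioo (0 : ℝ) 1)).map r) u = r u := by
  have hm : AEMeasurable r (volume.restrict (Ioo (0 : ℝ) 1)) :=
    aemeasurable_restrict_of_monotoneOn measurableSet_Ioo hr
  have := Measure.isProbabilityMeasure_map (μ := volume.restrict (Ioo (0 : ℝ) 1)) hm
  have key : ∀ x, r u ≤ x ↔
      u ≤ (((volume.restrict (Ioo (0 : ℝ) 1)).map r) (Iic x)).toReal := by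
    intro x
    rw [← ENNReal.ofReal_le_iff_le_toReal (measure_ne_top _ _),
      Measure.map_apply_of_aemeasurable hm measurableSet_Iic,
      Measure.restrict_apply' measurableSet_Ioo]
    constructor
    · intro h
      calc ENNReal.ofReal u = volume (Ioo 0 u) := by simp
        _ ≤ volume (r ⁻¹' Iic x ∩ Ioo 0 1) := measure_mono fun v hv =>
          have hv' : v ∈ Ioo (0 : ℝ) 1 := ⟨hv.1, hv.2.trans hu.2⟩
          ⟨(hr hv' hu hv.2.le).trans h, hv'⟩
    · intro h
      by_contra! hx
      have h1 : ∀ᶠ v in 𝓝 u, x < r v :=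
        (hc.continuousAt (isOpen_Ioo.mem_nhds hu)).eventually (lt_mem_nhds hx)
      obtain ⟨w, ⟨hw, hw0⟩, hwu⟩ := (((h1.and (lt_mem_nhds hu.1)).filter_mono
        nhdsWithin_le_nhds).and (self_mem_nhdsWithin (s := Iio u))).exists
      have h2 : volume (r ⁻¹' Iic x ∩ Ioo 0 1) ≤ volume (Ioo 0 w) := by
        refine measure_mono fun v hv => ⟨hv.2.1, ?_⟩
        by_contra! hwv
        have := hr ⟨hw0, lt_trans hwu hu.2⟩ hv.2 hwv
        exact absurd hv.1 (not_le.2 (hw.trans_le this))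
      have h3 := h.trans h2
      simp only [Real.volume_Ioo, sub_zero] at h3
      exact absurd ((ENNReal.ofReal_le_ofReal_iff hw0.le).1 h3) (not_le.2 hwu)
  exact eq_of_forall_ge_iff fun x => (quantile_le_iff hu x).trans (key x).symm

end Quantile

section Minimizer

lemma sq_sub_le_sq_sub_of_mem_uIcc {r q g : ℝ} (h : r ∈ uIcc q g) : (r - g) ^ 2 ≤ (q - g) ^ 2 := by
  rcases mem_uIcc.1 h with h | h <;> nlinarith

lemma eq_of_mem_uIcc_of_sq_sub_eq {r q g : ℝ} (h : r ∈ uIcc q g)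
    (he : (r - g) ^ 2 = (q - g) ^ 2) : r = q := by
  rcases sq_eq_sq_iff_eq_or_eq_neg.1 he with he | he
  · linarith
  · rcases mem_uIcc.1 h with h | h <;> linarith

lemma quantile_eqOn_of_minimizer {μ ν : Measure ℝ} (hμ : HasFiniteMomentP 2 μ)
    (hμ0 : ∀ u ∈ Ioo (0 : ℝ) 1, 0 ≤ quantile μ u) (hν : ν ∈ Fmp 2)
    (hmin : ∀ σ ∈ Fmp 2, Wdist 2 ν μ ≤ Wdist 2 σ μ) {r : ℝ → ℝ}
    (hr : ConvexOn ℝ (Ioo 0 1) r) (hlim : Tendsto r (𝓝[>] 0) (𝓝 0))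
    (hmem : ∀ u ∈ Ioo (0 : ℝ) 1, r u ∈ uIcc (quantile ν u) (quantile μ u)) :
    EqOn r (quantile ν) (Ioo 0 1) := by
  obtain ⟨⟨hνP, hνI⟩, -, hνc, hνm, hνl⟩ := hν
  obtain ⟨hμP, hμI⟩ := hμ
  have hν0 : ∀ u ∈ Ioo (0 : ℝ) 1, 0 ≤ quantile ν u := fun u hu =>
    hνm.nonneg_of_tendsto_zero hνl hu
  have hr0 : ∀ u ∈ Ioo (0 : ℝ) 1, 0 ≤ r u := fun u hu =>
    (le_inf (hν0 u hu) (hμ0 u hu)).trans (hmem u hu).1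
  have hrm := hr.monotoneOn_of_nonneg_of_tendsto_zero hr0 hlim
  have hrc := hr.continuousOn isOpen_Ioo
  have hrmeas : AEMeasurable r (volume.restrict (Ioo (0 : ℝ) 1)) :=
    aemeasurable_restrict_of_monotoneOn measurableSet_Ioo hrm
  have hqr : EqOn (quantile ((volume.restrict (Ioo (0 : ℝ) 1)).map r)) r (Ioo 0 1) :=
    fun u hu => quantile_map_restrict hrm hrc hu
  have hLν := memLp_quantile hνI
  have hLμ := memLp_quantile hμI
  have hLr : MemLp r 2 (volume.restrict (Ioo (0 : ℝ) 1)) := by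
    refine (hLν.add hLμ).mono hrmeas.aestronglyMeasurable ?_
    filter_upwards [ae_restrict_mem measurableSet_Ioo] with u hu
    have h1 : r u ≤ quantile ν u ⊔ quantile μ u := (hmem u hu).2
    have h2 : quantile ν u ⊔ quantile μ u ≤ quantile ν u + quantile μ u :=
      sup_le (by linarith [hμ0 u hu]) (by linarith [hν0 u hu])
    simp only [Pi.add_apply, Real.norm_eq_abs]
    rw [abs_of_nonneg (hr0 u hu)]
    exact (h1.trans h2).trans (le_abs_self _)
  have hmap : (volume.restrict (Ioo (0 : ℝ) 1)).map r ∈ Fmp 2 := by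
    refine ⟨⟨Measure.isProbabilityMeasure_map hrmeas, ?_⟩, ?_, hr.congr hqr.symm,
      hrm.congr hqr.symm, hlim.congr' ?_⟩
    · rw [integrable_map_measure (by simp only [Real.rpow_two]; fun_prop) hrmeas]
      refine hLr.integrable_sq.congr (.of_forall fun u => ?_)
      simp
    · rw [Measure.map_apply_of_aemeasurable hrmeas measurableSet_Iio,
        Measure.restrict_apply' measurableSet_Ioo]
      convert measure_empty (μ := (volume : Measure ℝ))
      ext u
      simp only [mem_inter_iff, mem_preimage, mem_Iio, mem_empty_iff_false, iff_false, not_and]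
      exact fun h hu => absurd (hr0 u hu) (not_le.2 h)
    · filter_upwards [Ioo_mem_nhdsGT one_pos] with u hu using (hqr hu).symm
  have hW := hmin _ hmap
  have hint : ∫ u in Ioo (0 : ℝ) 1, (quantile ν u - quantile μ u) ^ 2 ≤
      ∫ u in Ioo (0 : ℝ) 1, (r u - quantile μ u) ^ 2 := by
    unfold Wdist at hW
    simp only [Real.rpow_two, sq_abs] at hW
    rw [Real.rpow_le_rpow_iff (integral_nonneg fun _ => sq_nonneg _)
      (integral_nonneg fun _ => sq_nonneg _) (by norm_num)] at hW
    exact hW.trans_eq (setIntegral_congr_fun measurableSet_Ioo fun u hu => by simp only [hqr hu])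
  have hle : (fun u => (r u - quantile μ u) ^ 2) ≤ᵐ[volume.restrict (Ioo (0 : ℝ) 1)]
      fun u => (quantile ν u - quantile μ u) ^ 2 := by
    filter_upwards [ae_restrict_mem measurableSet_Ioo] with u hu
    exact sq_sub_le_sq_sub_of_mem_uIcc (hmem u hu)
  have hI1 := (hLr.sub hLμ).integrable_sq
  have hI2 := (hLν.sub hLμ).integrable_sq
  have hae := (integral_eq_iff_of_ae_le hI1 hI2 hle).1
    (le_antisymm (integral_mono_ae hI1 hI2 hle) hint)
  refine Measure.eqOn_open_of_ae_eq (μ := volume) ?_ isOpen_Ioo hrc (hνc.continuousOn isOpen_Ioo)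
  filter_upwards [hae, ae_restrict_mem measurableSet_Ioo] with u h hu
  exact eq_of_mem_uIcc_of_sq_sub_eq (hmem u hu) h

end Minimizer

section Shape

/-- `f` is affine on the nondegenerate open interval `(a, b)`. -/
def AffinePiece (f : ℝ → ℝ) (a b : ℝ) : Prop :=
  a < b ∧ ∃ A B : ℝ, ∀ u ∈ Ioo a b, f u = A + B * u

lemma reflTransGen_affinePiece {f : ℝ → ℝ} {a b : ℝ} (hab : a ≤ b)
    (h : ∃ A B : ℝ, ∀ u ∈ Ioo a b, f u = A + B * u) :
    Relation.ReflTransGen (AffinePiece f) a b := by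
  rcases hab.eq_or_lt with rfl | hab
  · exact .refl
  · exact .single ⟨hab, h⟩

lemma exists_partition_of_reflTransGen {f : ℝ → ℝ} {a b : ℝ}
    (h : Relation.ReflTransGen (AffinePiece f) a b) :
    ∃ (K : ℕ) (t : ℕ → ℝ), t 0 = a ∧ t K = b ∧ ∀ i < K, AffinePiece f (t i) (t (i + 1)) := by
  induction h with
  | refl => exact ⟨0, fun _ => a, rfl, rfl, by simp⟩
  | @tail b c _ hbc ih =>
    obtain ⟨K, t, h0, hK, ht⟩ := ih
    refine ⟨K + 1, fun i => if i ≤ K then t i else c, by simpa using h0, by simp, fun i hi => ?_⟩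
    rcases (Nat.lt_succ_iff.1 hi).eq_or_lt with rfl | hi
    · simpa [hK] using hbc
    · simpa [hi.le, Nat.succ_le_of_lt hi] using ht i hi

lemma exists_affine_of_collinear {f : ℝ → ℝ} {a b : ℝ} (hab : a < b)
    (h : ∀ x y z, a < x → x < y → y < z → z < b →
      (z - x) * f y = (z - y) * f x + (y - x) * f z) :
    ∃ A B : ℝ, ∀ u ∈ Ioo a b, f u = A + B * u := by
  obtain ⟨p, hap, hpb⟩ := exists_between hab
  obtain ⟨q, hpq, hqb⟩ := exists_between hpb
  have hne : q - p ≠ 0 := (sub_pos.2 hpq).ne'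
  refine ⟨f p - (f q - f p) / (q - p) * p, (f q - f p) / (q - p), fun u hu => ?_⟩
  have key : (q - p) * f u = (q - u) * f p + (u - p) * f q := by
    rcases lt_trichotomy u p with h1 | rfl | h1
    · linarith [h u p q hu.1 h1 hpq hqb]
    · ring
    rcases lt_trichotomy u q with h2 | rfl | h2
    · exact h p u q hap h1 h2 hqb
    · ring
    · linarith [h p q u hap hpq h2 hu.2]
  field_simp
  linarith

lemma exists_sign_change {α β a b : ℝ} (hab : a < b) (ha : 0 ≤ α + β * a) (hb : α + β * b ≤ 0) :
    ∃ s ∈ Icc a b, (∀ u ≤ s, 0 ≤ α + β * u) ∧ ∀ u, s ≤ u → α + β * u ≤ 0 := by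
  have hc : ContinuousOn (fun u => α + β * u) (Icc a b) := by fun_prop
  obtain ⟨s, hs, h0⟩ := intermediate_value_Icc' hab.le hc ⟨hb, ha⟩
  have hβ : β ≤ 0 := by nlinarith
  simp only at h0
  exact ⟨s, hs, fun u hu => by nlinarith, fun u hu => by nlinarith⟩

lemma MonotoneOn.exists_crossing {f : ℝ → ℝ} {a b : ℝ} (hf : MonotoneOn f (Ioo a b)) (hab : a < b)
    (c : ℝ) : ∃ s ∈ Icc a b, (∀ u ∈ Ioo a s, f u ≤ c) ∧ ∀ u ∈ Ioo s b, c ≤ f u := by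
  set S : Set ℝ := insert a {u | u ∈ Ioo a b ∧ f u ≤ c} with hS
  have hSb : ∀ v ∈ S, v ≤ b := by
    rintro v (rfl | hv)
    · exact hab.le
    · exact hv.1.2.le
  have hbdd : BddAbove S := ⟨b, hSb⟩
  refine ⟨sSup S, ⟨le_csSup hbdd (mem_insert _ _), csSup_le ⟨a, mem_insert _ _⟩ hSb⟩,
    fun u hu => ?_, fun u hu => ?_⟩
  · obtain ⟨v, hv, huv⟩ := exists_lt_of_lt_csSup ⟨a, mem_insert _ _⟩ hu.2
    rcases hv with rfl | hv
    · exact absurd huv hu.1.not_gt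
    · exact (hf ⟨hu.1, huv.trans hv.1.2⟩ hv.1 huv.le).trans hv.2
  · by_contra! h
    have hau : a < u := lt_of_le_of_lt (le_csSup hbdd (mem_insert _ _)) hu.1
    exact absurd (le_csSup hbdd (Or.inr ⟨⟨hau, hu.2⟩, h.le⟩)) hu.1.not_ge

/-- No convex function vanishing at `0+` lies between `q` and `g` except `q` itself. -/
def IsConvexExtremal (q g : ℝ → ℝ) : Prop :=
  ∀ r : ℝ → ℝ, ConvexOn ℝ (Ioo 0 1) r → Tendsto r (𝓝[>] 0) (𝓝 0) →
    (∀ u ∈ Ioo (0 : ℝ) 1, r u ∈ uIcc (q u) (g u)) → EqOn r q (Ioo 0 1)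

variable {q g : ℝ → ℝ} {a b c : ℝ}

lemma exists_affine_of_le (hq : ConvexOn ℝ (Ioo 0 1) q) (hqm : MonotoneOn q (Ioo 0 1))
    (hql : Tendsto q (𝓝[>] 0) (𝓝 0)) (hext : IsConvexExtremal q g) (ha : 0 ≤ a) (hb : b ≤ 1)
    (hab : a < b) (hg : ∀ u ∈ Ioo a b, g u = c) (hle : ∀ u ∈ Ioo a b, q u ≤ c) :
    ∃ A B : ℝ, ∀ u ∈ Ioo a b, q u = A + B * u := by
  refine exists_affine_of_collinear hab fun x y z hax hxy hyz hzb => ?_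
  have hx : x ∈ Ioo (0 : ℝ) 1 := ⟨by linarith, by linarith⟩
  have hy : y ∈ Ioo (0 : ℝ) 1 := ⟨by linarith, by linarith⟩
  have hz : z ∈ Ioo (0 : ℝ) 1 := ⟨by linarith, by linarith⟩
  have hzx : 0 < z - x := by linarith
  set B := (q z - q x) / (z - x) with hB
  have hBz : B * (z - x) = q z - q x := div_mul_cancel₀ _ hzx.ne'
  have hB0 : 0 ≤ B := div_nonneg (sub_nonneg.2 (hqm hx hz (by linarith))) hzx.le
  have hout : ∀ u ∈ Ioo (0 : ℝ) 1, u ∉ Ioo x z → q x + B * (u - x) ≤ q u := by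
    intro u hu hn
    rcases lt_trichotomy u x with h1 | rfl | h1
    · have := hq.le_chord hu hz h1 (by linarith)
      refine le_of_mul_le_mul_right ?_ hzx
      linear_combination this + (u - x) * hBz
    · simp
    rcases lt_trichotomy u z with h2 | rfl | h2
    · exact absurd ⟨h1, h2⟩ hn
    · linarith
    · have := hq.le_chord hx hu (by linarith) h2
      refine le_of_mul_le_mul_right ?_ hzx
      linear_combination this + (u - x) * hBz
  have hline : ConvexOn ℝ (Ioo 0 1) fun u => q x + B * (u - x) :=
    convexOn_of_exists_subgradient (convex_Ioo 0 1) fun u _ => ⟨B, fun v _ => by linarith⟩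
  have hr := hext _ (hq.sup hline) ?_ ?_ hy
  · have h1 : q x + B * (y - x) ≤ q y := by
      rw [← hr]
      exact le_sup_right
    refine le_antisymm (hq.le_chord hx hz hxy hyz) ?_
    have := mul_le_mul_of_nonneg_right h1 hzx.le
    linear_combination this - (y - x) * hBz
  · refine hql.congr' ?_
    filter_upwards [Ioo_mem_nhdsGT hx.1] with u hu
    exact (sup_of_le_left (hout u ⟨hu.1, hu.2.trans hx.2⟩ fun h => absurd h.1 hu.2.not_gt)).symm
  · intro u hu
    by_cases hm : u ∈ Ioo x z
    · have hu' : u ∈ Ioo a b := ⟨hax.trans hm.1, hm.2.trans hzb⟩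
      rw [hg u hu', uIcc_of_le (hle u hu')]
      refine ⟨le_sup_left, sup_le (hle u hu') ?_⟩
      have h1 : B * (u - x) ≤ B * (z - x) := mul_le_mul_of_nonneg_left (by linarith [hm.2]) hB0
      linarith [hle z ⟨by linarith, hzb⟩]
    · simp only [Pi.sup_apply, sup_of_le_left (hout u hu hm), left_mem_uIcc]

lemma convexOn_ite_max_support (hq : ConvexOn ℝ (Ioo 0 1) q) (ha : a ∈ Ioo (0 : ℝ) 1) (hab : a < b)
    {m A B : ℝ} (hm : ∀ u ∈ Ioo (0 : ℝ) 1, q a + m * (u - a) ≤ q u)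
    (hAB : ∀ u ∈ Ioo (0 : ℝ) 1, A + B * u ≤ q u) (hABb : b < 1 → A + B * b = q b) :
    ConvexOn ℝ (Ioo 0 1)
      (fun u => open Classical in
        if u ∈ Ioo a b then max (q a + m * (u - a)) (A + B * u) else q u) := by
  classical
  set r : ℝ → ℝ := fun u => if u ∈ Ioo a b then max (q a + m * (u - a)) (A + B * u) else q u
    with hrdef
  have hin : ∀ u ∈ Ioo a b, r u = max (q a + m * (u - a)) (A + B * u) := fun u hu => if_pos hu
  have hnot : ∀ u ∉ Ioo a b, r u = q u := fun u hu => if_neg hu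
  have hr1 : ∀ u ∈ Ioo (0 : ℝ) 1, q a + m * (u - a) ≤ r u := by
    intro u hu
    by_cases h : u ∈ Ioo a b
    · exact (le_max_left _ _).trans_eq (hin u h).symm
    · exact (hm u hu).trans_eq (hnot u h).symm
  have hr2 : ∀ u ∈ Ioo (0 : ℝ) 1, A + B * u ≤ r u := by
    intro u hu
    by_cases h : u ∈ Ioo a b
    · exact (le_max_right _ _).trans_eq (hin u h).symm
    · exact (hAB u hu).trans_eq (hnot u h).symm
  refine convexOn_of_exists_subgradient (convex_Ioo 0 1) fun z hz => ?_
  obtain ⟨k, hk⟩ := hq.exists_subgradient (x := z) (by rwa [isOpen_Ioo.interior_eq])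
  rcases lt_trichotomy z a with hza | rfl | hza
  · refine ⟨k, fun w hw => ?_⟩
    rw [hnot z fun h => absurd h.1 hza.not_gt]
    by_cases h : w ∈ Ioo a b
    · refine le_trans ?_ (hr1 w hw)
      have h1 := hk a ha
      have hkm : k ≤ m := by nlinarith [hm z hz]
      nlinarith [h.1]
    · exact (hk w hw).trans_eq (hnot w h).symm
  · exact ⟨m, fun w hw => by rw [hnot z fun h => absurd h.1 (lt_irrefl _)]; exact hr1 w hw⟩
  rcases lt_trichotomy z b with hzb | rfl | hzb
  · rw [hin z ⟨hza, hzb⟩]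
    rcases max_choice (q a + m * (z - a)) (A + B * z) with h | h
    · exact ⟨m, fun w hw => by rw [h]; linarith [hr1 w hw]⟩
    · exact ⟨B, fun w hw => by rw [h]; linarith [hr2 w hw]⟩
  · refine ⟨B, fun w hw => ?_⟩
    rw [hnot z fun h => absurd h.2 (lt_irrefl _), ← hABb hz.2]
    linarith [hr2 w hw]
  · refine ⟨k, fun w hw => ?_⟩
    rw [hnot z fun h => absurd h.2 hzb.not_gt]
    by_cases h : w ∈ Ioo a b
    · refine le_trans ?_ (hr2 w hw)
      have hb1 : b < 1 := hzb.trans hz.2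
      have h1 := hk b ⟨ha.1.trans hab, hb1⟩
      have h2 := hABb hb1
      have hkm : B ≤ k := by nlinarith [hAB z hz]
      nlinarith [h.2]
    · exact (hk w hw).trans_eq (hnot w h).symm

lemma reflTransGen_affinePiece_of_ge (hq : ConvexOn ℝ (Ioo 0 1) q)
    (hqm : MonotoneOn q (Ioo 0 1)) (hql : Tendsto q (𝓝[>] 0) (𝓝 0))
    (hext : IsConvexExtremal q g) (ha : 0 < a) (hb : b ≤ 1) (hab : a < b)
    (hg : ∀ u ∈ Ioo a b, g u = c) (hge : ∀ u ∈ Ioo a b, c ≤ q u) :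
    Relation.ReflTransGen (AffinePiece q) a b := by
  classical
  have ha' : a ∈ Ioo (0 : ℝ) 1 := ⟨ha, hab.trans_le hb⟩
  obtain ⟨m, hm⟩ := hq.exists_subgradient (x := a) (by rwa [isOpen_Ioo.interior_eq])
  obtain ⟨A, B, hAB, hABb, hmb⟩ : ∃ A B : ℝ, (∀ u ∈ Ioo (0 : ℝ) 1, A + B * u ≤ q u) ∧
      (b < 1 → A + B * b = q b) ∧ q a + m * (b - a) ≤ A + B * b := by
    rcases hb.eq_or_lt with rfl | hb
    · exact ⟨q a - m * a, m, fun u hu => by linarith [hm u hu], fun h => absurd h (lt_irrefl _),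
        by linarith⟩
    · have hb' : b ∈ Ioo (0 : ℝ) 1 := ⟨ha.trans hab, hb⟩
      obtain ⟨k, hk⟩ := hq.exists_subgradient (x := b) (by rwa [isOpen_Ioo.interior_eq])
      exact ⟨q b - k * b, k, fun u hu => by linarith [hk u hu], fun _ => by ring,
        by linarith [hm b hb']⟩
  have hsub : Ioo a b ⊆ Ioo (0 : ℝ) 1 := Ioo_subset_Ioo ha.le hb
  have hm0 : 0 ≤ m := by
    have h2 : a / 2 ∈ Ioo (0 : ℝ) 1 := ⟨by linarith, by linarith⟩
    have := hm _ h2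
    have := hqm h2 ha' (by linarith)
    nlinarith
  have hca : c ≤ q a := by
    have hcont : ContinuousAt q a :=
      (hq.continuousOn isOpen_Ioo).continuousAt (isOpen_Ioo.mem_nhds ha')
    refine ge_of_tendsto (hcont.tendsto.mono_left (nhdsWithin_le_nhds (s := Ioi a))) ?_
    filter_upwards [Ioo_mem_nhdsGT hab] with u hu using hge u hu
  have hr := hext _ (convexOn_ite_max_support hq ha' hab hm hAB hABb) ?_ ?_
  · have hmax : ∀ u ∈ Ioo a b, q u = max (q a + m * (u - a)) (A + B * u) := fun u hu => by
      have := hr (hsub hu)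
      simp only [if_pos hu] at this
      exact this.symm
    obtain ⟨s, hs, hs1, hs2⟩ := exists_sign_change (α := q a - m * a - A) (β := m - B) hab
      (by linarith [hAB a ha']) (by linarith)
    refine (reflTransGen_affinePiece hs.1 ⟨q a - m * a, m, fun u hu => ?_⟩).trans
      (reflTransGen_affinePiece hs.2 ⟨A, B, fun u hu => ?_⟩)
    · rw [hmax u ⟨hu.1, hu.2.trans_le hs.2⟩, max_eq_left (by linarith [hs1 u hu.2.le])]
      ring
    · rw [hmax u ⟨hs.1.trans_lt hu.1, hu.2⟩, max_eq_right (by linarith [hs2 u hu.1.le])]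
  · refine hql.congr' ?_
    filter_upwards [Ioo_mem_nhdsGT ha] with u hu
    exact (if_neg fun h => absurd h.1 hu.2.not_gt).symm
  · intro u hu
    by_cases h : u ∈ Ioo a b
    · simp only [if_pos h]
      rw [hg u h, uIcc_of_ge (hge u h)]
      refine ⟨le_max_of_le_left ?_, max_le (hm u hu) (hAB u hu)⟩
      nlinarith [h.1]
    · simp only [if_neg h, left_mem_uIcc]

lemma reflTransGen_affinePiece_of_const (hq : ConvexOn ℝ (Ioo 0 1) q)
    (hqm : MonotoneOn q (Ioo 0 1)) (hql : Tendsto q (𝓝[>] 0) (𝓝 0))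
    (hext : IsConvexExtremal q g) (ha : 0 ≤ a) (hb : b ≤ 1) (hab : a < b) (hc : 0 < c)
    (hg : ∀ u ∈ Ioo a b, g u = c) : Relation.ReflTransGen (AffinePiece q) a b := by
  obtain ⟨s, hs, hs1, hs2⟩ := (hqm.mono (Ioo_subset_Ioo ha hb)).exists_crossing hab c
  have hs0 : 0 < s := by
    refine (ha.trans hs.1).lt_of_ne ?_
    rintro rfl
    have hb0 : 0 < b := by linarith [hs.1]
    refine absurd (ge_of_tendsto hql ?_) (not_le.2 hc)
    filter_upwards [Ioo_mem_nhdsGT hb0] with u hu using hs2 u hu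
  have h1 : Relation.ReflTransGen (AffinePiece q) a s := by
    rcases hs.1.eq_or_lt with rfl | has
    · exact .refl
    · exact .single ⟨has, exists_affine_of_le hq hqm hql hext ha (hs.2.trans hb) has
        (fun u hu => hg u ⟨hu.1, hu.2.trans_le hs.2⟩) hs1⟩
  refine h1.trans ?_
  rcases hs.2.eq_or_lt with rfl | hsb
  · exact .refl
  · exact reflTransGen_affinePiece_of_ge hq hqm hql hext hs0 hb hsb
      (fun u hu => hg u ⟨hs.1.trans_lt hu.1, hu.2⟩) hs2

end Shape

section Empirical

variable {n : ℕ} {x : ℕ → ℝ}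

lemma empirical_apply_toReal {s : Set ℝ} (hs : MeasurableSet s) [DecidablePred (· ∈ s)] :
    (((n : ENNReal)⁻¹ • ∑ i ∈ Finset.range n, Measure.dirac (x i)) s).toReal =
      (n : ℝ)⁻¹ * ((Finset.range n).filter fun i => x i ∈ s).card := by
  simp [Measure.dirac_apply' _ hs, Set.indicator_apply]

lemma hasFiniteMomentP_empirical (hn : 0 < n) (p : ℝ) :
    HasFiniteMomentP p ((n : ENNReal)⁻¹ • ∑ i ∈ Finset.range n, Measure.dirac (x i)) := by
  have hn' : (n : ENNReal) ≠ 0 := by exact_mod_cast hn.ne'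
  refine ⟨⟨?_⟩, ?_⟩
  · simp [ENNReal.inv_mul_cancel hn' (ENNReal.natCast_ne_top n)]
  · refine Integrable.smul_measure ?_ (ENNReal.inv_ne_top.2 hn')
    rw [integrable_finsetSum_measure]
    exact fun i _ => integrable_dirac (by simp)

lemma quantile_empirical_pos (hn : 0 < n) (hx : ∀ i < n, 0 < x i) {u : ℝ}
    (hu : u ∈ Ioo (0 : ℝ) 1) :
    0 < quantile ((n : ENNReal)⁻¹ • ∑ i ∈ Finset.range n, Measure.dirac (x i)) u := by
  classical
  have := (hasFiniteMomentP_empirical (x := x) hn 2).1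
  have h := (quantile_le_iff hu _).1 (le_refl
    (quantile ((n : ENNReal)⁻¹ • ∑ i ∈ Finset.range n, Measure.dirac (x i)) u))
  rw [empirical_apply_toReal measurableSet_Iic] at h
  by_contra! hneg
  rw [Finset.filter_false_of_mem] at h
  · simp at h
    linarith [hu.1]
  · exact fun i hi hle => absurd (hx i (Finset.mem_range.1 hi)) (not_lt.2 (hle.trans hneg))

lemma quantile_empirical_eq_of_mem_Ioo (hn : 0 < n) {k : ℕ} {u v : ℝ}
    (hu : u ∈ Ioo ((k : ℝ) / n) ((k + 1 : ℕ) / n)) (hv : v ∈ Ioo ((k : ℝ) / n) ((k + 1 : ℕ) / n)) :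
    quantile ((n : ENNReal)⁻¹ • ∑ i ∈ Finset.range n, Measure.dirac (x i)) u =
      quantile ((n : ENNReal)⁻¹ • ∑ i ∈ Finset.range n, Measure.dirac (x i)) v := by
  classical
  have hn' : (0 : ℝ) < n := by exact_mod_cast hn
  have key : ∀ w ∈ Ioo ((k : ℝ) / n) ((k + 1 : ℕ) / n), ∀ j : ℕ,
      w ≤ (n : ℝ)⁻¹ * j ↔ k + 1 ≤ j := by
    intro w hw j
    rw [← div_eq_inv_mul]
    constructor
    · intro h
      have h1 := (div_lt_div_iff_of_pos_right hn').1 (hw.1.trans_le h)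
      exact_mod_cast h1
    · intro h
      refine hw.2.le.trans ((div_le_div_iff_of_pos_right hn').2 ?_)
      exact_mod_cast h
  unfold quantile
  congr 1
  ext y
  simp only [mem_ofPred_eq, empirical_apply_toReal measurableSet_Iic, key u hu, key v hv]

end Empirical

lemma exists_bound_of_affinePiece {f : ℝ → ℝ} (hf : MonotoneOn f (Ioo 0 1))
    (hf0 : ∀ u ∈ Ioo (0 : ℝ) 1, 0 ≤ f u) {a : ℝ} (h : AffinePiece f a 1) :
    ∃ C : ℝ, ∀ u ∈ Ioo (0 : ℝ) 1, |f u| ≤ C := by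
  obtain ⟨ha1, A, B, hAB⟩ := h
  refine ⟨|A| + |B|, fun u hu => ?_⟩
  rw [abs_of_nonneg (hf0 u hu)]
  obtain ⟨v, hv, hv1⟩ := exists_between (max_lt ha1 hu.2)
  have hv' : v ∈ Ioo (0 : ℝ) 1 := ⟨hu.1.trans ((le_max_right _ _).trans_lt hv), hv1⟩
  refine (hf hu hv' ((le_max_right _ _).trans hv.le)).trans ?_
  rw [hAB v ⟨(le_max_left _ _).trans_lt hv, hv1⟩]
  refine add_le_add (le_abs_self A) ((le_abs_self _).trans ?_)
  rw [abs_mul, abs_of_pos hv'.1]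
  exact mul_le_of_le_one_right (abs_nonneg _) hv1.le

/-- Theorem 3.7, structure of the monotone Wasserstein projection
estimator. Let `μn = (1/n) Σ_{i<n} δ_{x_i}` with `x_0, …, x_{n-1} > 0`, and let `μhat`
be the Wasserstein projection of `μn` onto `F_{m,2}` (the unique minimizer of
`ν ↦ W_2(ν, μn)`). Then `μhat` has a non-increasing, compactly supported, piecewise
constant density with finitely many pieces; equivalently (as stated here), the quantile
function of `μhat` is bounded on `(0,1)` and piecewise affine with finitely many pieces. -/
theorem wasserstein_projection_monotone_piecewise_constant
    (n : ℕ) (hn : 0 < n) (x : ℕ → ℝ) (hx : ∀ i < n, 0 < x i)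
    (μn : MeasureTheory.Measure ℝ)
    (hμn : μn = (n : ENNReal)⁻¹ • ∑ i ∈ Finset.range n, MeasureTheory.Measure.dirac (x i))
    (μhat : MeasureTheory.Measure ℝ)
    (hμhatF : μhat ∈ Fmp 2)
    (hμhatmin : ∀ ν ∈ Fmp 2, Wdist 2 μhat μn ≤ Wdist 2 ν μn) :
    (∃ C : ℝ, ∀ u ∈ Set.Ioo (0:ℝ) 1, |quantile μhat u| ≤ C) ∧
    (∃ (K : ℕ) (t : ℕ → ℝ), 0 < K ∧ t 0 = 0 ∧ t K = 1 ∧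
      (∀ i < K, t i < t (i + 1)) ∧
      (∀ i < K, ∃ a b : ℝ, ∀ u ∈ Set.Ioo (t i) (t (i + 1)),
        quantile μhat u = a + b * u)) := by
  subst hμn
  set μn : Measure ℝ := (n : ENNReal)⁻¹ • ∑ i ∈ Finset.range n, Measure.dirac (x i)
  have hpos : ∀ u ∈ Ioo (0 : ℝ) 1, 0 < quantile μn u := fun u hu => quantile_empirical_pos hn hx hu
  have hext : IsConvexExtremal (quantile μhat) (quantile μn) := fun r hr hlim hmem =>
    quantile_eqOn_of_minimizer (hasFiniteMomentP_empirical hn 2) (fun u hu => (hpos u hu).le)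
      hμhatF hμhatmin hr hlim hmem
  obtain ⟨-, -, hqc, hqm, hql⟩ := hμhatF
  have hn' : (0 : ℝ) < n := by exact_mod_cast hn
  have hchain : ∀ k ≤ n,
      Relation.ReflTransGen (AffinePiece (quantile μhat)) 0 ((k : ℝ) / n) := by
    intro k
    induction k with
    | zero => exact fun _ => by simpa using Relation.ReflTransGen.refl
    | succ k ih =>
      intro hk
      have hlt : (k : ℝ) / n < (k + 1 : ℕ) / n :=
        (div_lt_div_iff_of_pos_right hn').2 (by exact_mod_cast k.lt_succ_self)
      have h0 : (0 : ℝ) ≤ k / n := by positivity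
      have h1 : ((k + 1 : ℕ) : ℝ) / n ≤ 1 := (div_le_one hn').2 (by exact_mod_cast hk)
      obtain ⟨p, hp⟩ := exists_between hlt
      exact (ih (by omega)).trans (reflTransGen_affinePiece_of_const hqc hqm hql hext h0 h1 hlt
        (hpos p ⟨h0.trans_lt hp.1, hp.2.trans_le h1⟩)
        fun u hu => quantile_empirical_eq_of_mem_Ioo hn hu hp)
  have h01 := hchain n le_rfl
  rw [div_self hn'.ne'] at h01
  refine ⟨?_, ?_⟩
  · obtain h | ⟨a, -, hpiece⟩ := Relation.ReflTransGen.cases_tail h01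
    · exact absurd h one_ne_zero
    exact exists_bound_of_affinePiece hqm (fun u hu => hqm.nonneg_of_tendsto_zero hql hu) hpiece
  · obtain ⟨K, t, h0, hK, ht⟩ := exists_partition_of_reflTransGen h01
    refine ⟨K, t, Nat.pos_of_ne_zero ?_, h0, hK, fun i hi => (ht i hi).1, fun i hi => (ht i hi).2⟩
    rintro rfl
    exact zero_ne_one (h0.symm.trans hK)
end

section
/- Let μ be a Borel probability measure on ℝ with quantile function Q = Q_μ. Then μ is log-concave if and only if either (i) Q is constant on (0,1), or (ii) Q is absolutely continuous on (0,1) and there exists a version of its derivative Q' such that Q'(u) > 0 for all u ∈ (0,1) and the function u ↦ 1/Q'(u) is concave on (0,1). -/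
open MeasureTheory Set Filter

/-- A Borel probability measure on `ℝ` is log-concave if it is a point mass, or it has a
density `f` with respect to Lebesgue measure such that `log f : ℝ → [−∞, ∞)` is concave;
the latter is expressed by the multiplicative inequality
`f((1−t)x + ty) ≥ f(x)^(1−t) · f(y)^t`. -/
def IsLogConcave (μ : MeasureTheory.Measure ℝ) : Prop :=
  (∃ x : ℝ, μ = MeasureTheory.Measure.dirac x) ∨
  ∃ f : ℝ → ℝ, (∀ x, 0 ≤ f x) ∧
    μ = MeasureTheory.volume.withDensity (fun x => ENNReal.ofReal (f x)) ∧
    ∀ x y : ℝ, ∀ t ∈ Set.Icc (0:ℝ) 1,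
      f x ^ (1 - t) * f y ^ t ≤ f ((1 - t) * x + t * y)

/-- The set `F_lc` of log-concave probability measures on `ℝ`. -/
def Flc : Set (MeasureTheory.Measure ℝ) :=
  {μ | MeasureTheory.IsProbabilityMeasure μ ∧ IsLogConcave μ}

open scoped Topology

lemma ConcaveOn.exists_antitoneOn_hasDerivWithinAt_Ioi {S : Set ℝ} {φ : ℝ → ℝ}
    (hφ : ConcaveOn ℝ S φ) (hS : IsOpen S) :
    ∃ d : ℝ → ℝ, AntitoneOn d S ∧ ∀ x ∈ S, HasDerivWithinAt φ (d x) (Ioi x) x := by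
  refine ⟨fun x => -derivWithin (-φ) (Ioi x) x, ?_, fun x hx => ?_⟩
  · have h := hφ.neg.monotoneOn_rightDeriv
    rw [hS.interior_eq] at h
    exact h.neg
  · have h := hφ.neg.hasDerivWithinAt_rightDeriv_of_mem_interior (hS.interior_eq.symm ▸ hx)
    simpa using h.neg

lemma concaveOn_of_antitoneOn_hasDerivWithinAt_Ioi {D : Set ℝ} {k k' : ℝ → ℝ}
    (hD : Convex ℝ D) (hc : ContinuousOn k D)
    (hd : ∀ x ∈ D, HasDerivWithinAt k (k' x) (Ioi x) x) (hk' : AntitoneOn k' D) :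
    ConcaveOn ℝ D k := by
  have hlin : ∀ (c : ℝ) (s : Set ℝ) (x : ℝ), HasDerivWithinAt (fun y => c * y) c s x := by
    intro c s x
    simpa using (hasDerivWithinAt_id x s).const_mul c
  refine concaveOn_of_slope_anti_adjacent hD ?_
  intro x y z hx hz hxy hyz
  have hD' : OrdConnected D := hD.ordConnected
  have hy : y ∈ D := hD'.out hx hz ⟨hxy.le, hyz.le⟩
  have hxy' : Icc x y ⊆ D := hD'.out hx hy
  have hyz' : Icc y z ⊆ D := hD'.out hy hz
  have h1 : k z - k' y * z ≤ k y - k' y * y := by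
    refine image_le_of_deriv_right_le_deriv_boundary (f := fun t => k t - k' y * t)
      (f' := fun t => k' t - k' y) (B := fun _ => k y - k' y * y) (B' := fun _ => 0)
      ((hc.mono hyz').sub (by fun_prop)) (fun t ht => ?_) le_rfl continuousOn_const
      (fun t _ => hasDerivWithinAt_const ..) (fun t ht => ?_) (right_mem_Icc.2 hyz.le)
    · exact (hd t (hyz' (Ico_subset_Icc_self ht))).Ici_of_Ioi.sub (hlin _ _ _)
    · have := hk' hy (hyz' (Ico_subset_Icc_self ht)) ht.1
      linarith
  have h2 : k x - k' y * x ≤ k y - k' y * y := by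
    refine image_le_of_deriv_right_le_deriv_boundary (f := fun _ => k x - k' y * x)
      (f' := fun _ => 0) (B := fun t => k t - k' y * t) (B' := fun t => k' t - k' y)
      continuousOn_const (fun t _ => hasDerivWithinAt_const ..) le_rfl
      ((hc.mono hxy').sub (by fun_prop)) (fun t ht => ?_)
      (fun t ht => ?_) (right_mem_Icc.2 hxy.le)
    · exact (hd t (hxy' (Ico_subset_Icc_self ht))).Ici_of_Ioi.sub (hlin _ _ _)
    · have := hk' (hxy' (Ico_subset_Icc_self ht)) hy ht.2.le
      linarith
  calc (k z - k y) / (z - y) ≤ k' y := by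
        rw [div_le_iff₀ (sub_pos.2 hyz)]; linarith
    _ ≤ (k y - k x) / (y - x) := by
        rw [le_div_iff₀ (sub_pos.2 hxy)]; linarith

lemma StrictMonoOn.of_rightInverse {A B : Set ℝ} {g h : ℝ → ℝ} (hh : MapsTo h B A)
    (hg : StrictMonoOn g A) (hgh : ∀ y ∈ B, g (h y) = y) : StrictMonoOn h B := by
  intro y₁ h₁ y₂ h₂ h12
  by_contra! hcon
  have := hg.monotoneOn (hh h₂) (hh h₁) hcon
  rw [hgh _ h₁, hgh _ h₂] at this
  linarith

lemma StrictMonoOn.hasDerivAt_rightInverse {A B : Set ℝ} {g h g' : ℝ → ℝ} (hA : IsOpen A)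
    (hB : IsOpen B) (hgA : MapsTo g A B) (hh : MapsTo h B A) (hg : StrictMonoOn g A)
    (hgh : ∀ y ∈ B, g (h y) = y) (hg' : ∀ x ∈ A, HasDerivAt g (g' x) x)
    (hpos : ∀ x ∈ A, 0 < g' x) {y : ℝ} (hy : y ∈ B) : HasDerivAt h (g' (h y))⁻¹ y := by
  have hsub : A ⊆ h '' B := fun x hx =>
    ⟨g x, hgA hx, hg.injOn (hh (hgA hx)) hx (hgh _ (hgA hx))⟩
  have hcont : ContinuousAt h y :=
    (hg.of_rightInverse hh hgh).continuousAt_of_image_mem_nhds (hB.mem_nhds hy)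
      (Filter.mem_of_superset (hA.mem_nhds (hh hy)) hsub)
  exact (hg' _ (hh hy)).of_local_left_inverse hcont (hpos _ (hh hy)).ne'
    (Filter.eventually_of_mem (hB.mem_nhds hy) hgh)

lemma StrictMonoOn.isOpen_image_Ioo {a b : ℝ} {g : ℝ → ℝ} (hg : StrictMonoOn g (Ioo a b))
    (hc : ContinuousOn g (Ioo a b)) : IsOpen (g '' Ioo a b) := by
  rw [isOpen_iff_mem_nhds]
  rintro _ ⟨u, hu, rfl⟩
  obtain ⟨u₁, h1, h1u⟩ := exists_between hu.1
  obtain ⟨u₂, hu2, h2⟩ := exists_between hu.2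
  have m1 : u₁ ∈ Ioo a b := ⟨h1, h1u.trans hu.2⟩
  have m2 : u₂ ∈ Ioo a b := ⟨hu.1.trans hu2, h2⟩
  have hsub : Icc u₁ u₂ ⊆ Ioo a b := ordConnected_Ioo.out m1 m2
  refine Filter.mem_of_superset (Icc_mem_nhds (hg m1 hu h1u) (hg hu m2 hu2)) ?_
  exact (intermediate_value_Icc (h1u.trans hu2).le (hc.mono hsub)).trans (image_mono hsub)

section Quantile

variable {μ : Measure ℝ} [IsProbabilityMeasure μ]

lemma toReal_measure_Iic_mono : Monotone fun x => (μ (Iic x)).toReal := fun _ _ h =>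
  ENNReal.toReal_mono (measure_ne_top _ _) (measure_mono (Iic_subset_Iic.2 h))

lemma toReal_measure_Iic_eq_cdf :
    (fun x => (μ (Iic x)).toReal) = ProbabilityTheory.cdf μ :=
  funext fun x => (ProbabilityTheory.cdf_eq_real μ x).symm

lemma tendsto_toReal_measure_Iic_atBot :
    Tendsto (fun x => (μ (Iic x)).toReal) atBot (𝓝 0) := by
  rw [toReal_measure_Iic_eq_cdf]
  exact ProbabilityTheory.tendsto_cdf_atBot μ

lemma tendsto_toReal_measure_Iic_atTop :
    Tendsto (fun x => (μ (Iic x)).toReal) atTop (𝓝 1) := by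
  rw [toReal_measure_Iic_eq_cdf]
  exact ProbabilityTheory.tendsto_cdf_atTop μ

lemma continuousWithinAt_toReal_measure_Iic (x : ℝ) :
    ContinuousWithinAt (fun x => (μ (Iic x)).toReal) (Ici x) x := by
  rw [toReal_measure_Iic_eq_cdf]
  exact (ProbabilityTheory.cdf μ).right_continuous x

lemma continuous_toReal_measure_Iic [NullSingletonClass μ] :
    Continuous fun x => (μ (Iic x)).toReal := by
  rw [toReal_measure_Iic_eq_cdf, continuous_iff_continuousAt]
  have hmono := ProbabilityTheory.monotone_cdf μ
  refine fun x => continuousAt_iff_continuous_left_right.2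
    ⟨continuousWithinAt_Iio_iff_Iic.1 (hmono.continuousWithinAt_Iio_iff_leftLim_eq.2 ?_),
      (ProbabilityTheory.cdf μ).right_continuous x⟩
  have h := (ProbabilityTheory.cdf μ).measure_singleton x
  rw [ProbabilityTheory.measure_cdf, measure_singleton, eq_comm, ENNReal.ofReal_eq_zero] at h
  exact le_antisymm (hmono.leftLim_le le_rfl) (by linarith)

lemma quantile_dirac (c : ℝ) {u : ℝ} (hu : u ∈ Ioo (0 : ℝ) 1) :
    quantile (Measure.dirac c) u = c := by
  have h := fun x => quantile_le_iff (μ := Measure.dirac c) hu x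
  refine le_antisymm ((h c).2 (by simp [hu.2.le])) ?_
  by_contra! hlt
  have := (h _).1 le_rfl
  rw [Measure.dirac_apply' _ measurableSet_Iic, indicator_of_notMem (by simpa using hlt)] at this
  simp only [ENNReal.toReal_zero] at this
  exact this.not_gt hu.1

lemma eq_dirac_of_quantile_eq {c : ℝ} (h : ∀ u ∈ Ioo (0 : ℝ) 1, quantile μ u = c) :
    μ = Measure.dirac c := by
  refine Measure.ext_of_Iic _ _ fun x => ?_
  rw [Measure.dirac_apply' _ measurableSet_Iic]
  have hle : (μ (Iic x)).toReal ≤ 1 := measureReal_le_one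
  rw [← ENNReal.toReal_eq_toReal_iff' (measure_ne_top _ _) (by by_cases hx : c ≤ x <;> simp [hx])]
  by_cases hx : c ≤ x
  · rw [indicator_of_mem (by simpa using hx)]
    refine le_antisymm (by simpa using hle) (le_of_forall_lt fun v hv => ?_)
    simp only [Pi.one_apply, ENNReal.toReal_one] at hv
    obtain ⟨w, hw, hw1⟩ := exists_between (max_lt hv one_pos)
    have hw' : w ∈ Ioo (0 : ℝ) 1 := ⟨(le_max_right _ _).trans_lt hw, hw1⟩
    exact ((le_max_left _ _).trans_lt hw).trans_le
      ((quantile_le_iff hw' x).1 ((h w hw').trans_le hx))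
  · rw [indicator_of_notMem (by simpa using hx), ENNReal.toReal_zero]
    refine le_antisymm (le_of_forall_gt fun v hv => ?_) ENNReal.toReal_nonneg
    by_contra! hcon
    obtain ⟨w, hw, hw1⟩ := exists_between (lt_min hv one_pos)
    have hw' : w ∈ Ioo (0 : ℝ) 1 := ⟨hw, hw1.trans_le (min_le_right _ _)⟩
    have := (quantile_le_iff hw' x).2 ((hw1.trans_le (min_le_left _ _)).le.trans hcon)
    exact hx ((h w hw').symm.trans_le this)

lemma isLogConcave_of_quantile {q : ℝ → ℝ}
    (hpos : ∀ u ∈ Ioo (0 : ℝ) 1, 0 < q u)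
    (hconc : ConcaveOn ℝ (Ioo (0 : ℝ) 1) fun u => (q u)⁻¹)
    (hint : ∀ u ∈ Ioo (0 : ℝ) 1, ∀ v ∈ Ioo (0 : ℝ) 1, u ≤ v →
      quantile μ v - quantile μ u = ∫ s in u..v, q s) :
    IsLogConcave μ := by
  set J : Set ℝ := Ioo 0 1 with hJ
  set Q := quantile μ with hQ
  set F : ℝ → ℝ := fun x => (μ (Iic x)).toReal with hF
  have hJo : IsOpen J := isOpen_Ioo
  have hhc : ContinuousOn (fun u => (q u)⁻¹) J := hconc.continuousOn hJo
  have hqc : ContinuousOn q J := by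
    exact (hhc.inv₀ fun u hu => (inv_pos.2 (hpos u hu)).ne').congr fun u _ => (inv_inv _).symm
  have hQd : ∀ u ∈ J, HasDerivAt Q (q u) u := by
    intro u hu
    obtain ⟨a, ha0, hau⟩ := exists_between hu.1
    have ha : a ∈ J := ⟨ha0, hau.trans hu.2⟩
    have hi : IntervalIntegrable q volume a u := by
      refine (hqc.mono ?_).intervalIntegrable
      exact ordConnected_Ioo.uIcc_subset ha hu
    have hd := (intervalIntegral.integral_hasDerivAt_right hi
      (hqc.stronglyMeasurableAtFilter hJo u hu) (hqc.continuousAt (hJo.mem_nhds hu))).const_add (Q a)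
    refine hd.congr_of_eventuallyEq ?_
    filter_upwards [hJo.mem_nhds hu, Ioi_mem_nhds hau] with v hv hav
    rw [← hint a ha v hv (le_of_lt hav)]
    ring
  have hQm : StrictMonoOn Q J := by
    refine strictMonoOn_of_hasDerivWithinAt_pos (convex_Ioo 0 1)
      (fun u hu => (hQd u hu).continuousAt.continuousWithinAt) (f' := q) ?_ ?_
    · intro u hu
      rw [interior_Ioo] at hu
      exact (hQd u hu).hasDerivWithinAt
    · intro u hu
      rw [interior_Ioo] at hu
      exact hpos u hu
  have hQc : ContinuousOn Q J := fun u hu => (hQd u hu).continuousAt.continuousWithinAt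
  set I : Set ℝ := Q '' J with hI
  have hIo : IsOpen I := hQm.isOpen_image_Ioo hQc
  have hIc : Convex ℝ I :=
    (isPreconnected_Ioo.image Q hQc).ordConnected.convex
  have hFQ : ∀ u ∈ J, F (Q u) = u := by
    intro u hu
    refine le_antisymm ?_ ((quantile_le_iff hu _).1 le_rfl)
    by_contra! hlt
    obtain ⟨v, huv, hv⟩ := exists_between (lt_min hlt hu.2)
    have hv' : v ∈ J := ⟨hu.1.trans huv, hv.trans_le (min_le_right _ _)⟩
    have := (quantile_le_iff hv' _).2 (hv.trans_le (min_le_left _ _)).le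
    exact (hQm hu hv' huv).not_ge this
  have hFJ : MapsTo F I J := by
    rintro _ ⟨u, hu, rfl⟩
    rwa [hFQ u hu]
  have hQF : ∀ x ∈ I, Q (F x) = x := by
    rintro _ ⟨u, hu, rfl⟩
    rw [hFQ u hu]
  have hFm : StrictMonoOn F I := hQm.of_rightInverse hFJ hQF
  have hFd : ∀ x ∈ I, HasDerivAt F (q (F x))⁻¹ x := fun x hx =>
    hQm.hasDerivAt_rightInverse hJo hIo (mapsTo_image Q J) hFJ hQF hQd hpos hx
  have hFc : ContinuousOn F I := fun x hx => (hFd x hx).continuousAt.continuousWithinAt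
  set f : ℝ → ℝ := I.indicator fun x => (q (F x))⁻¹ with hf
  have hfpos : ∀ x ∈ I, 0 < f x := fun x hx => by
    rw [hf, indicator_of_mem hx]
    exact inv_pos.2 (hpos _ (hFJ hx))
  have hf0 : ∀ x, x ∉ I → f x = 0 := fun x hx => indicator_of_notMem hx _
  have hfnonneg : ∀ x, 0 ≤ f x := fun x => by
    by_cases hx : x ∈ I
    · exact (hfpos x hx).le
    · exact (hf0 x hx).ge
  have hlog : ConcaveOn ℝ I fun x => Real.log (q (F x))⁻¹ := by
    obtain ⟨d, hd, hd'⟩ := hconc.exists_antitoneOn_hasDerivWithinAt_Ioi hJo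
    refine concaveOn_of_antitoneOn_hasDerivWithinAt_Ioi (k' := fun x => d (F x)) hIc ?_ ?_ ?_
    · exact (hhc.comp hFc hFJ).log fun x hx => (inv_pos.2 (hpos _ (hFJ hx))).ne'
    · intro x hx
      have hne : (q (F x))⁻¹ ≠ 0 := (inv_pos.2 (hpos _ (hFJ hx))).ne'
      have hcomp : HasDerivWithinAt (fun x => (q (F x))⁻¹) (d (F x) * (q (F x))⁻¹)
          (I ∩ Ioi x) x :=
        (hd' (F x) (hFJ hx)).comp x (hFd x hx).hasDerivWithinAt
          fun y hy => hFm hx hy.1 hy.2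
      have hcomp' := (hcomp.log hne)
      rw [mul_div_cancel_right₀ _ hne] at hcomp'
      rw [inter_comm] at hcomp'
      exact (hasDerivWithinAt_inter (hIo.mem_nhds hx)).1 hcomp'
    · exact fun x hx y hy hxy => hd (hFJ hx) (hFJ hy) (hFm.monotoneOn hx hy hxy)
  refine Or.inr ⟨f, hfnonneg, ?_, ?_⟩
  · refine Measure.ext_of_Iic _ _ fun x => ?_
    have hmeas : MeasurableSet (Iic x ∩ I) := measurableSet_Iic.inter hIo.measurableSet
    have himage : F '' (Iic x ∩ I) = J ∩ Iic (F x) := by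
      ext u
      constructor
      · rintro ⟨y, ⟨hyx, hy⟩, rfl⟩
        exact ⟨hFJ hy, toReal_measure_Iic_mono hyx⟩
      · rintro ⟨hu, hux⟩
        exact ⟨Q u, ⟨(quantile_le_iff hu x).2 hux, mem_image_of_mem Q hu⟩, hFQ u hu⟩
    have hvol : volume (J ∩ Iic (F x)) = ENNReal.ofReal (F x) := by
      have h1 : F x ≤ 1 := measureReal_le_one
      refine le_antisymm ?_ ?_
      · refine (measure_mono (t := Ioc 0 (F x)) fun u hu => ⟨hu.1.1, hu.2⟩).trans ?_
        simp
      · refine le_trans ?_ (measure_mono (s := Ioo 0 (F x))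
          fun u hu => ⟨⟨hu.1, hu.2.trans_le h1⟩, hu.2.le⟩)
        simp
    have hind : (fun y => ENNReal.ofReal (f y)) =
        I.indicator fun y => ENNReal.ofReal (q (F y))⁻¹ := by
      funext y
      by_cases hy : y ∈ I <;> simp [hf, hy]
    rw [withDensity_apply _ measurableSet_Iic, hind, setLIntegral_indicator hIo.measurableSet,
      inter_comm, lintegral_deriv_eq_volume_image_of_monotoneOn hmeas
        (fun y hy => (hFd y hy.2).hasDerivWithinAt)
        (hFm.monotoneOn.mono inter_subset_right), himage, hvol,
      ENNReal.ofReal_toReal (measure_ne_top _ _)]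
  · intro x y t ht
    rcases ht.1.eq_or_lt with rfl | ht0
    · simp
    rcases ht.2.eq_or_lt with rfl | ht1
    · simp
    by_cases hx : x ∈ I
    swap
    · rw [hf0 x hx, Real.zero_rpow (by linarith), zero_mul]
      exact hfnonneg _
    by_cases hy : y ∈ I
    swap
    · rw [hf0 y hy, Real.zero_rpow ht0.ne', mul_zero]
      exact hfnonneg _
    have hz : (1 - t) * x + t * y ∈ I := hIc hx hy (by linarith) ht.1 (by ring)
    have hflog : ∀ x ∈ I, f x = Real.exp (Real.log (q (F x))⁻¹) := fun x hx => by
      rw [hf, indicator_of_mem hx, Real.exp_log (inv_pos.2 (hpos _ (hFJ hx)))]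
    rw [hflog x hx, hflog y hy, hflog _ hz, ← Real.exp_mul, ← Real.exp_mul, ← Real.exp_add,
      Real.exp_le_exp]
    have := hlog.2 hx hy (by linarith : 0 ≤ 1 - t) ht.1 (by ring)
    simp only [smul_eq_mul] at this
    linarith

lemma exists_quantile_deriv_of_logConcave_density {f : ℝ → ℝ} (hf0 : ∀ x, 0 ≤ f x)
    (hμ : μ = volume.withDensity fun x => ENNReal.ofReal (f x))
    (hlc : ∀ x y : ℝ, ∀ t ∈ Icc (0 : ℝ) 1,
      f x ^ (1 - t) * f y ^ t ≤ f ((1 - t) * x + t * y)) :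
    ∃ q : ℝ → ℝ, (∀ u ∈ Ioo (0 : ℝ) 1, 0 < q u) ∧
      ConcaveOn ℝ (Ioo (0 : ℝ) 1) (fun u => (q u)⁻¹) ∧
      (∀ u ∈ Ioo (0 : ℝ) 1, ∀ v ∈ Ioo (0 : ℝ) 1, IntervalIntegrable q volume u v) ∧
      (∀ u ∈ Ioo (0 : ℝ) 1, ∀ v ∈ Ioo (0 : ℝ) 1, u ≤ v →
        quantile μ v - quantile μ u = ∫ s in u..v, q s) := by
  set J : Set ℝ := Ioo 0 1 with hJ
  have hJo : IsOpen J := isOpen_Ioo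
  set Q := quantile μ with hQ
  set F : ℝ → ℝ := fun x => (μ (Iic x)).toReal with hF
  have hFmono : Monotone F := toReal_measure_Iic_mono
  set S : Set ℝ := {x | 0 < f x} with hS
  have hSc : Convex ℝ S := by
    intro x hx y hy a b ha hb hab
    have hpos : 0 < f x ^ (1 - b) * f y ^ b :=
      mul_pos (Real.rpow_pos_of_pos hx _) (Real.rpow_pos_of_pos hy _)
    have := hpos.trans_le (hlc x y b ⟨hb, by linarith⟩)
    rwa [show 1 - b = a by linarith] at this
  set I : Set ℝ := interior S with hI
  have hIo : IsOpen I := isOpen_interior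
  have hIc : Convex ℝ I := hSc.interior
  have hIS : I ⊆ S := interior_subset
  set φ : ℝ → ℝ := fun x => Real.log (f x) with hφ
  have hφc : ConcaveOn ℝ I φ := by
    refine ⟨hIc, fun x hx y hy a b ha hb hab => ?_⟩
    have hx' : 0 < f x := hIS hx
    have hy' : 0 < f y := hIS hy
    have h := hlc x y b ⟨hb, by linarith⟩
    rw [show 1 - b = a by linarith] at h
    have h' := Real.log_le_log
      (mul_pos (Real.rpow_pos_of_pos hx' _) (Real.rpow_pos_of_pos hy' _)) h
    rwa [Real.log_mul (Real.rpow_pos_of_pos hx' _).ne' (Real.rpow_pos_of_pos hy' _).ne',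
      Real.log_rpow hx', Real.log_rpow hy'] at h'
  have hfexp : ∀ x ∈ I, f x = Real.exp (φ x) := fun x hx => (Real.exp_log (hIS hx)).symm
  have hfc : ContinuousOn f I := (hφc.continuousOn hIo).rexp.congr hfexp
  have hac : μ ≪ volume := hμ ▸ withDensity_absolutelyContinuous _ _
  have hIcompl : μ Iᶜ = 0 := by
    have h1 : μ Sᶜ = 0 := by
      have hz : ∀ x ∈ Sᶜ, ENNReal.ofReal (f x) = 0 := fun x hx =>
        ENNReal.ofReal_eq_zero.2 (not_lt.1 hx)
      have hm : MeasurableSet Sᶜ := hSc.ordConnected.measurableSet.compl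
      rw [hμ, withDensity_apply _ hm, setLIntegral_congr_fun hm hz, lintegral_zero]
    have h2 : μ (frontier S) = 0 := hac (hSc.addHaar_frontier volume)
    refine measure_mono_null (t := Sᶜ ∪ frontier S) (fun x hx => ?_) (measure_union_null h1 h2)
    by_cases hxS : x ∈ S
    · exact Or.inr ⟨subset_closure hxS, hx⟩
    · exact Or.inl hxS
  have hFint : ∀ x ∈ I, ∀ y ∈ I, x ≤ y → F y = F x + ∫ s in x..y, f s := by
    intro x hx y hy hxy
    have hIcc : Icc x y ⊆ I := hIc.ordConnected.out hx hy
    have hi : IntegrableOn f (Ioc x y) :=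
      ((hfc.mono hIcc).integrableOn_Icc).mono_set Ioc_subset_Icc_self
    have hIoc : (μ (Ioc x y)).toReal = ∫ s in x..y, f s := by
      rw [intervalIntegral.integral_of_le hxy,
        integral_eq_lintegral_of_nonneg_ae (ae_of_all _ hf0) hi.1]
      conv_lhs => rw [hμ, withDensity_apply _ measurableSet_Ioc]
    rw [← hIoc, ← ENNReal.toReal_add (measure_ne_top _ _) (measure_ne_top _ _),
      ← measure_union (Iic_disjoint_Ioc le_rfl) measurableSet_Ioc, Iic_union_Ioc_eq_Iic hxy]
  have hFd : ∀ x ∈ I, HasDerivAt F (f x) x := by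
    intro x hx
    obtain ⟨a, hax : a < x, ha⟩ := mem_nhdsLE_iff_exists_Icc_subset.1
      (mem_nhdsWithin_of_mem_nhds (hIo.mem_nhds hx))
    have haI : a ∈ I := ha (left_mem_Icc.2 hax.le)
    have hi : IntervalIntegrable f volume a x := by
      refine (hfc.mono ?_).intervalIntegrable
      rwa [uIcc_of_le hax.le]
    have hd := (intervalIntegral.integral_hasDerivAt_right hi
      (hfc.stronglyMeasurableAtFilter hIo x hx) (hfc.continuousAt (hIo.mem_nhds hx))).const_add (F a)
    refine hd.congr_of_eventuallyEq ?_
    filter_upwards [hIo.mem_nhds hx, Ioi_mem_nhds hax] with v hv hav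
    exact hFint a haI v hv (le_of_lt hav)
  have hFc : ContinuousOn F I := fun x hx => (hFd x hx).continuousAt.continuousWithinAt
  have hFm : StrictMonoOn F I := by
    refine strictMonoOn_of_hasDerivWithinAt_pos hIc hFc (f' := f) ?_ ?_
    · intro x hx
      rw [hIo.interior_eq] at hx
      exact (hFd x hx).hasDerivWithinAt
    · intro x hx
      rw [hIo.interior_eq] at hx
      exact hIS hx
  have hlt : ∀ x ∈ I, ∀ y < x, F y < F x := by
    intro x hx y hyx
    obtain ⟨z, hz, hzI⟩ := mem_nhdsLE_iff_exists_Icc_subset.1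
      (mem_nhdsWithin_of_mem_nhds (hIo.mem_nhds hx))
    obtain ⟨w, hw, hwx⟩ := exists_between (max_lt hyx hz)
    have hwI : w ∈ I := hzI ⟨((le_max_right _ _).trans_lt hw).le, hwx.le⟩
    exact (hFmono ((le_max_left _ _).trans_lt hw).le).trans_lt (hFm hwI hx hwx)
  have hFJ : MapsTo F I J := by
    intro x hx
    refine ⟨ENNReal.toReal_nonneg.trans_lt (hlt x hx (x - 1) (by linarith)), ?_⟩
    obtain ⟨z, hz, hzI⟩ := mem_nhdsGE_iff_exists_Icc_subset.1
      (mem_nhdsWithin_of_mem_nhds (hIo.mem_nhds hx))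
    exact (hFm hx (hzI (right_mem_Icc.2 (le_of_lt hz))) hz).trans_le measureReal_le_one
  have hQF : ∀ x ∈ I, Q (F x) = x := by
    intro x hx
    refine le_antisymm ((quantile_le_iff (hFJ hx) x).2 le_rfl) ?_
    by_contra! hcon
    exact (hlt x hx _ hcon).not_ge ((quantile_le_iff (hFJ hx) _).1 le_rfl)
  have hsurj : ∀ u ∈ J, ∃ x ∈ I, F x = u := by
    intro u hu
    have : NullSingletonClass μ := ⟨fun x => hac Real.volume_singleton⟩
    have hFcont : Continuous F := continuous_toReal_measure_Iic
    obtain ⟨a, ha⟩ := ((tendsto_toReal_measure_Iic_atBot (μ := μ)).eventually_lt_const hu.1).exists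
    obtain ⟨b, hb⟩ := ((tendsto_toReal_measure_Iic_atTop (μ := μ)).eventually_const_lt hu.2).exists
    obtain ⟨x, hx⟩ := mem_range_of_exists_le_of_exists_ge hFcont ⟨a, ha.le⟩ ⟨b, hb.le⟩
    refine ⟨x, ?_, hx⟩
    by_contra hxI
    have hor : I ⊆ Iic x ∨ Iic x ⊆ Iᶜ := by
      by_contra! hcon
      obtain ⟨⟨y, hy, hyx⟩, ⟨z, hz, hzI⟩⟩ := And.imp not_subset.1 not_subset.1 hcon
      exact hxI (hIc.ordConnected.out (not_not.1 hzI) hy ⟨hz, (not_le.1 hyx).le⟩)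
    rcases hor with h | h
    · have h1 : μ (Iic x)ᶜ = 0 := measure_mono_null (compl_subset_compl.2 h) hIcompl
      have h2 : F x = 1 := by
        simp only [hF]
        rw [(prob_compl_eq_zero_iff measurableSet_Iic).1 h1, ENNReal.toReal_one]
      exact hu.2.ne (hx.symm.trans h2)
    · have h1 : F x = 0 := by
        simp only [hF]
        rw [measure_mono_null h hIcompl, ENNReal.toReal_zero]
      exact hu.1.ne (h1.symm.trans hx)
  have hQI : MapsTo Q J I := by
    intro u hu
    obtain ⟨x, hx, rfl⟩ := hsurj u hu
    rwa [hQF x hx]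
  have hFQ : ∀ u ∈ J, F (Q u) = u := by
    intro u hu
    obtain ⟨x, hx, rfl⟩ := hsurj u hu
    rw [hQF x hx]
  have hQm : StrictMonoOn Q J := hFm.of_rightInverse hQI hFQ
  have hQd : ∀ u ∈ J, HasDerivAt Q (f (Q u))⁻¹ u := fun u hu =>
    hFm.hasDerivAt_rightInverse hIo hJo hFJ hQI hFQ hFd hIS hu
  have hQc : ContinuousOn Q J := fun u hu => (hQd u hu).continuousAt.continuousWithinAt
  have hfQc : ContinuousOn (fun u => f (Q u)) J := hfc.comp hQc hQI
  have hqc : ContinuousOn (fun u => (f (Q u))⁻¹) J :=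
    hfQc.inv₀ fun u hu => (hIS (hQI hu)).ne'
  have hqi : ∀ u ∈ J, ∀ v ∈ J, IntervalIntegrable (fun u => (f (Q u))⁻¹) volume u v :=
    fun u hu v hv => (hqc.mono (ordConnected_Ioo.uIcc_subset hu hv)).intervalIntegrable
  refine ⟨fun u => (f (Q u))⁻¹, fun u hu => inv_pos.2 (hIS (hQI hu)), ?_, hqi, ?_⟩
  · simp only [inv_inv]
    obtain ⟨d, hd, hd'⟩ := hφc.exists_antitoneOn_hasDerivWithinAt_Ioi hIo
    refine concaveOn_of_antitoneOn_hasDerivWithinAt_Ioi (k' := fun u => d (Q u)) (convex_Ioo 0 1)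
      hfQc (fun u hu => ?_) ?_
    · have hne : f (Q u) ≠ 0 := (hIS (hQI hu)).ne'
      have hcomp : HasDerivWithinAt (fun u => φ (Q u)) (d (Q u) * (f (Q u))⁻¹)
          (J ∩ Ioi u) u :=
        (hd' (Q u) (hQI hu)).comp u (hQd u hu).hasDerivWithinAt
          fun y hy => hQm hu hy.1 hy.2
      have hexp := hcomp.exp
      rw [← hfexp _ (hQI hu), mul_comm (d _), mul_inv_cancel_left₀ hne] at hexp
      have hexp' := hexp.congr (fun y hy => hfexp _ (hQI hy.1)) (hfexp _ (hQI hu))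
      rw [inter_comm] at hexp'
      exact (hasDerivWithinAt_inter (hJo.mem_nhds hu)).1 hexp'
    · exact fun u hu v hv huv => hd (hQI hu) (hQI hv) (hQm.monotoneOn hu hv huv)
  · intro u hu v hv _
    exact (intervalIntegral.integral_eq_sub_of_hasDerivAt
      (fun w hw => hQd w (ordConnected_Ioo.uIcc_subset hu hv hw)) (hqi u hu v hv)).symm

end Quantile

/-- Lemma 4.1, quantile characterization of log-concavity.
A Borel probability measure `μ` on `ℝ` with quantile function `Q` is log-concave if and
only if either (i) `Q` is constant on `(0,1)`, or (ii) `Q` is absolutely continuous on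
`(0,1)` and there is a version `q` of its derivative with `q > 0` on `(0,1)` such that
`u ↦ 1/q(u)` is concave on `(0,1)`. -/
theorem isLogConcave_iff_quantile
    (μ : MeasureTheory.Measure ℝ) [MeasureTheory.IsProbabilityMeasure μ] :
    IsLogConcave μ ↔
      ((∀ u ∈ Set.Ioo (0:ℝ) 1, ∀ v ∈ Set.Ioo (0:ℝ) 1, quantile μ u = quantile μ v) ∨
       (∃ q : ℝ → ℝ,
          (∀ u ∈ Set.Ioo (0:ℝ) 1, 0 < q u) ∧
          ConcaveOn ℝ (Set.Ioo (0:ℝ) 1) (fun u => (q u)⁻¹) ∧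
          (∀ u ∈ Set.Ioo (0:ℝ) 1, ∀ v ∈ Set.Ioo (0:ℝ) 1,
            IntervalIntegrable q MeasureTheory.volume u v) ∧
          (∀ u ∈ Set.Ioo (0:ℝ) 1, ∀ v ∈ Set.Ioo (0:ℝ) 1, u ≤ v →
            quantile μ v - quantile μ u = ∫ s in u..v, q s))) := by
  constructor
  · rintro (⟨x, rfl⟩ | ⟨f, hf0, hμ, hlc⟩)
    · exact Or.inl fun u hu v hv => by rw [quantile_dirac x hu, quantile_dirac x hv]
    · exact Or.inr (exists_quantile_deriv_of_logConcave_density hf0 hμ hlc)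
  · rintro (h | ⟨q, hpos, hconc, -, hint⟩)
    · have hhalf : (1 / 2 : ℝ) ∈ Ioo (0 : ℝ) 1 := by norm_num
      exact Or.inl ⟨_, eq_dirac_of_quantile_eq fun u hu => h u hu _ hhalf⟩
    · exact isLogConcave_of_quantile hpos hconc hint
end
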